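/- If f ∈ Homeo₀(T²) has a δ-upper-stable rotation set (in Homeo₀(T²)) for some δ > 0, then there exists a constant C > 0 such that for every lift f̃ of f and every (δ/2)-pseudo-orbit (x̃_i)_{i∈ℕ} of f̃ in ℝ² one has d(x̃_n − x̃_0, n·ρ(f̃)) ≤ C for all n ∈ ℕ, where n·ρ(f̃) = {n v : v ∈ ρ(f̃)}. -/

import Mathlib

noncomputable section

open Metric Set Filter Topology MeasureTheory Pointwise

/-- The plane `ℝ²` with the Euclidean metric. -/
abbrev R2 : Type := EuclideanSpace ℝ (Fin 2)

/-- The integer lattice `ℤ² ⊂ ℝ²`. -/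
def intLattice : AddSubgroup R2 where
  carrier := {v : R2 | ∀ i, ∃ n : ℤ, v i = (n : ℝ)}
  add_mem' := by
    intro a b ha hb i
    obtain ⟨m, hm⟩ := ha i
    obtain ⟨n, hn⟩ := hb i
    exact ⟨m + n, by push_cast; rw [← hm, ← hn]; rfl⟩
  zero_mem' := fun i => ⟨0, by simp⟩
  neg_mem' := by
    intro a ha i
    obtain ⟨m, hm⟩ := ha i
    exact ⟨-m, by push_cast; rw [← hm]; rfl⟩

/-- The torus `T² = ℝ²/ℤ²`, with the quotient (Euclidean) metric. -/
abbrev T2 : Type := R2 ⧸ intLattice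

/-- The covering projection `π : ℝ² → T²`. -/
def pr : R2 → T2 := QuotientAddGroup.mk

instance : MeasurableSpace T2 := borel T2
instance : BorelSpace T2 := ⟨rfl⟩

/-- A fundamental domain `[0,1)²` for the lattice action. -/
def fundDomain : Set R2 := {x : R2 | ∀ i, x i ∈ Set.Ico (0 : ℝ) 1}

/-- Lebesgue (Haar) probability measure on the torus `T²`. -/
def lebT2 : Measure T2 := Measure.map pr (volume.restrict fundDomain)

/-- `F : ℝ² → ℝ²` is a lift of `f : T² → T²` if `π ∘ F = f ∘ π` and
`F (x + w) = F x + w` for every lattice vector `w ∈ ℤ²`. -/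
structure IsLift (f : T2 ≃ₜ T2) (F : R2 ≃ₜ R2) : Prop where
  proj : ∀ x : R2, pr (F x) = f (pr x)
  equivariant : ∀ x : R2, ∀ w ∈ intLattice, F (x + w) = F x + w

/-- `Homeo₀(T²)`: homeomorphisms of the torus isotopic to the identity,
characterized as those admitting a lift commuting with integer translations. -/
def Homeo0 : Set (T2 ≃ₜ T2) := {f | ∃ F : R2 ≃ₜ R2, IsLift f F}

/-- `Homeo_{0,λ}(T²)`: elements of `Homeo₀(T²)` preserving Lebesgue measure. -/
def Homeo0Leb : Set (T2 ≃ₜ T2) :=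
  {f | f ∈ Homeo0 ∧ MeasurePreserving f lebT2 lebT2}

/-- The uniform `C⁰` distance `d_{C⁰}(f,g) = sup_x d(f(x), g(x))` on torus maps. -/
def dC0 (f g : T2 ≃ₜ T2) : ℝ := ⨆ x : T2, dist (f x) (g x)

/-- The uniform distance `sup_{x ∈ ℝ²} ‖F(x) − G(x)‖` between maps of the plane. -/
def supDist (F G : R2 → R2) : ℝ := ⨆ x : R2, dist (F x) (G x)

/-- The rotation set `ρ(F̃)` of a lift: all limits `(F̃^{n_k}(z_k) − z_k)/n_k`. -/
def rotSet (F : R2 ≃ₜ R2) : Set R2 :=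
  {v | ∃ (z : ℕ → R2) (n : ℕ → ℕ), Tendsto n atTop atTop ∧
    Tendsto (fun k => (n k : ℝ)⁻¹ • ((⇑F)^[n k] (z k) - z k)) atTop (𝓝 v)}

/-- The rotation set of `f`, with fixed lift `F`, is `δ`-upper-stable in `H`. -/
def UpperStable (H : Set (T2 ≃ₜ T2)) (F : R2 ≃ₜ R2) (δ : ℝ) : Prop :=
  ∀ g ∈ H, ∀ G : R2 ≃ₜ R2, IsLift g G → supDist (⇑F) (⇑G) < δ →
    rotSet G ⊆ rotSet F

/-- The rotation set of `f`, with fixed lift `F`, is `δ`-stable in `H`. -/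
def StableRS (H : Set (T2 ≃ₜ T2)) (F : R2 ≃ₜ R2) (δ : ℝ) : Prop :=
  ∀ g ∈ H, ∀ G : R2 ≃ₜ R2, IsLift g G → supDist (⇑F) (⇑G) < δ →
    rotSet G = rotSet F

/-- `f` has a stable rotation set in `H`. -/
def HasStableRotSet (H : Set (T2 ≃ₜ T2)) (f : T2 ≃ₜ T2) : Prop :=
  ∃ F : R2 ≃ₜ R2, IsLift f F ∧ ∃ δ > 0, StableRS H F δ

/-- `S` is open in `H` for the uniform `C⁰` topology. -/
def OpenIn (H S : Set (T2 ≃ₜ T2)) : Prop :=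
  ∀ f ∈ S ∩ H, ∃ δ > 0, ∀ g ∈ H, dC0 f g < δ → g ∈ S

/-- `S` is dense in `H` for the uniform `C⁰` topology. -/
def DenseIn (H S : Set (T2 ≃ₜ T2)) : Prop :=
  ∀ f ∈ H, ∀ ε > 0, ∃ g ∈ S ∩ H, dC0 f g < ε

/-- `(x_i)_{0 ≤ i ≤ n}` is a finite `ε`-pseudo-orbit of `F`. -/
def IsPseudoOrbitUpTo (F : R2 → R2) (ε : ℝ) (x : ℕ → R2) (n : ℕ) : Prop :=
  ∀ i < n, dist (F (x i)) (x (i + 1)) < ε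

/-- `(x_i)_{i ∈ ℕ}` is an infinite `ε`-pseudo-orbit of `F`. -/
def IsPseudoOrbit (F : R2 → R2) (ε : ℝ) (x : ℕ → R2) : Prop :=
  ∀ i : ℕ, dist (F (x i)) (x (i + 1)) < ε

/-- The `ε`-pseudo-rotation set `ρ_ε(F̃)`. -/
def pseudoRotSet (F : R2 → R2) (ε : ℝ) : Set R2 :=
  {v | ∃ (n : ℕ → ℕ) (x : ℕ → ℕ → R2), Tendsto n atTop atTop ∧
    (∀ k, IsPseudoOrbitUpTo F ε (x k) (n k)) ∧
    Tendsto (fun k => (n k : ℝ)⁻¹ • (x k (n k) - x k 0)) atTop (𝓝 v)}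

/-- The oscillation `osc(f) = sup_{x,y} ‖(F(x) − x) − (F(y) − y)‖` of a lift. -/
def osc (F : R2 → R2) : ℝ := ⨆ p : R2 × R2, ‖(F p.1 - p.1) - (F p.2 - p.2)‖

/-- `f` has the shadowing property. -/
def Shadowing (f : T2 ≃ₜ T2) : Prop :=
  ∀ ε > 0, ∃ δ > 0, ∀ x : ℕ → T2, (∀ i, dist (f (x i)) (x (i + 1)) < δ) →
    ∃ z : T2, ∀ i, dist ((⇑f)^[i] z) (x i) < ε

/-- `v ∈ ℚ² ⊂ ℝ²`. -/
def IsRationalPoint (v : R2) : Prop := ∀ i, ∃ q : ℚ, v i = (q : ℝ)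


section Winding
open Complex
lemma exists_log {A : Type*} [TopologicalSpace A] [SimplyConnectedSpace A] [LocallyPathConnectedSpace A]
    (h : A → ℂ) (hc : Continuous h) (h0 : ∀ a, h a ≠ 0) (a₀ : A) :
    ∃ l : A → ℂ, Continuous l ∧ ∀ a, exp (l a) = h a := by
  obtain ⟨F, ⟨h1, h2⟩, -⟩ := isCoveringMapOn_exp.existsUnique_continuousMap_lifts
    (f := (⟨h, hc⟩ : C(A, ℂ))) (a₀ := a₀) (e₀ := Complex.log (h a₀)) (by simp [exp_log (h0 a₀)])
    (by rintro a; simpa using h0 a)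
  exact ⟨F, F.continuous, fun a => congrFun h2 a⟩

lemma const_of_exp_const (k : ℝ → ℂ) (hk : Continuous k) (c : ℂ) (h : ∀ t, exp (k t) = c) (s t : ℝ) :
    k s = k t := by
  have := isCoveringMap_exp.eq_of_comp_eq (g₁ := k) (g₂ := fun _ => k t) hk continuous_const
    (by funext r; simp [h]) t rfl
  exact congrFun this s

lemma wind (Γ : ℝ → ℂ) (hc : Continuous Γ) (a w : ℂ) (hΓ : ∀ s, 1 < ‖Γ s‖) (h0 : Γ 0 = a)
    (h1 : Γ 1 = -a) (haw : ‖a - w‖ ≤ 1) (hne : ∀ s t, Γ s - Γ t ≠ w) : False := by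
  have hΓ0 : ∀ s, Γ s ≠ 0 := fun s h => by have := hΓ s; rw [h] at this; norm_num at this
  obtain ⟨g, hgc, hg⟩ := exists_log Γ hc hΓ0 0
  obtain ⟨l, hlc, hl⟩ := exists_log (fun p : ℝ × ℝ => Γ p.1 - Γ p.2 - w) (by fun_prop)
    (fun p => sub_ne_zero.2 (hne _ _)) (0, 0)
  have hw : w ≠ 0 := fun h => hne 0 0 (by simp [h])
  have hq : ∀ s, ‖(a - w) / Γ s‖ < 1 := fun s => by
    rw [norm_div, div_lt_one (by linarith [hΓ s])]; linarith [hΓ s]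
  have hsl1 : ∀ s, 1 - (a - w) / Γ s ∈ slitPlane := fun s => by
    have := mem_slitPlane_of_norm_lt_one (z := -((a - w) / Γ s)) (by rw [norm_neg]; exact hq s)
    simpa [sub_eq_add_neg] using this
  have hsl2 : ∀ s, 1 + (a - w) / Γ s ∈ slitPlane := fun s => mem_slitPlane_of_norm_lt_one (hq s)
  have e1 := const_of_exp_const (fun t => l (0, t) - g t - log (1 - (a - w) / Γ t))
    (by
      refine (Continuous.sub (by fun_prop) hgc).sub (Continuous.clog ?_ hsl1)
      exact continuous_const.sub (continuous_const.div hc hΓ0)) (-1) (fun t => by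
      rw [exp_sub, exp_sub, hl, hg, exp_log (slitPlane_ne_zero (hsl1 t))]
      have := slitPlane_ne_zero (hsl1 t)
      have h3 := hΓ0 t
      rw [div_div, div_eq_iff (mul_ne_zero h3 this)]
      field_simp
      simp only [h0]; ring) 1 0
  have e2 := const_of_exp_const (fun t => l (t, 1) - g t - log (1 + (a - w) / Γ t))
    (by
      refine (Continuous.sub (by fun_prop) hgc).sub (Continuous.clog ?_ hsl2)
      exact continuous_const.add (continuous_const.div hc hΓ0)) (1) (fun t => by
      rw [exp_sub, exp_sub, hl, hg, exp_log (slitPlane_ne_zero (hsl2 t))]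
      have := slitPlane_ne_zero (hsl2 t)
      have h3 := hΓ0 t
      rw [div_div, div_eq_iff (mul_ne_zero h3 this)]
      field_simp
      simp only [h1]; ring) 1 0
  have e3 := const_of_exp_const (fun t => l (t, t)) (by fun_prop) (-w) (fun t => by rw [hl]; simp) 1 0
  have e4 : exp (g 1 - g 0) = -1 := by
    rw [exp_sub, hg, hg, h1, h0, neg_div, div_self]
    rw [← h0]; exact hΓ0 0
  simp only [h0, h1, div_neg, sub_neg_eq_add, ← sub_eq_add_neg] at e1 e2 e3
  have e5 : g 1 = g 0 := by linear_combination (e3 - e1 - e2) / 2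
  rw [e5] at e4; norm_num at e4

end Winding

lemma exists_lattice_near (z : R2) : ∃ w ∈ intLattice, ‖z - w‖ ≤ 1 := by
  refine ⟨!₂[((round (z 0) : ℤ) : ℝ), ((round (z 1) : ℤ) : ℝ)], ?_, ?_⟩
  · intro i
    fin_cases i
    · exact ⟨round (z 0), by simp⟩
    · exact ⟨round (z 1), by simp⟩
  · rw [EuclideanSpace.norm_eq, Real.sqrt_le_iff, Fin.sum_univ_two]
    refine ⟨zero_le_one, ?_⟩
    have h0 := abs_sub_round (z 0)
    have h1 := abs_sub_round (z 1)
    have e0 := sq_abs (z 0 - round (z 0))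
    have e1 := sq_abs (z 1 - round (z 1))
    have p0 := abs_nonneg (z 0 - round (z 0))
    have p1 := abs_nonneg (z 1 - round (z 1))
    simp only [PiLp.sub_apply, Real.norm_eq_abs]
    simp
    nlinarith

lemma midpoint_approx (Φ : R2 → R2) (hc : Continuous Φ) (hi : Function.Injective Φ)
    (he : ∀ x : R2, ∀ w ∈ intLattice, Φ (x + w) = Φ x + w) (x y : R2) :
    ∃ z, ‖(Φ z - z) - (1 / 2 : ℝ) • ((Φ x - x) + (Φ y - y))‖ ≤ 5 := by
  obtain ⟨u, hu, hxu⟩ := exists_lattice_near (y - x)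
  obtain ⟨y', rfl⟩ : ∃ y', y = y' + u := ⟨y - u, by simp⟩
  rw [he y' u hu, add_sub_add_right_eq_sub]
  have hd : ‖y' - x‖ ≤ 1 := by convert hxu using 2; abel
  clear hxu
  by_contra hcon
  push Not at hcon
  set cl : ℝ → ℝ := fun s => max 0 (min 1 s) with hcl
  have hcl0 : ∀ s, 0 ≤ cl s := fun s => le_max_left _ _
  have hcl1 : ∀ s, cl s ≤ 1 := fun s => max_le zero_le_one (min_le_left _ _)
  set X : ℝ → R2 := fun s => x + cl s • (y' - x) with hX
  set Γ : ℝ → R2 := fun s => Φ (X s) - (1 / 2 : ℝ) • (Φ x + Φ y') with hΓ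
  have hXc : Continuous X := by simp only [hX, hcl]; fun_prop
  have hX0 : X 0 = x := by simp [hX, hcl]
  have hX1 : X 1 = y' := by simp [hX, hcl]
  have hΓc : Continuous Γ := by simp only [hΓ]; fun_prop
  have hΓn : ∀ s, 4 < ‖Γ s‖ := by
    intro s
    have h1 := hcon (X s)
    have h2 : Φ (X s) - X s - (1 / 2 : ℝ) • (Φ x - x + (Φ y' - y')) =
        Γ s - (cl s - 1 / 2) • (y' - x) := by
      simp only [hΓ, hX]; module
    rw [h2] at h1
    have h3 := norm_sub_le (Γ s) ((cl s - 1 / 2) • (y' - x))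
    rw [norm_smul] at h3
    have h4 : ‖cl s - 1 / 2‖ ≤ 1 := by
      rw [Real.norm_eq_abs, abs_le]; constructor <;> linarith [hcl0 s, hcl1 s]
    nlinarith [norm_nonneg (y' - x), norm_nonneg (cl s - 1 / 2)]
  obtain ⟨w, hw, haw⟩ := exists_lattice_near (Γ 0)
  have hwn : 3 < ‖w‖ := by
    have h3 := norm_sub_norm_le (Γ 0) w
    linarith [hΓn 0]
  let T := Complex.orthonormalBasisOneI.repr.symm
  refine wind (fun s => T (Γ s)) (T.continuous.comp hΓc) (T (Γ 0)) (T w) (fun s => ?_) rfl ?_ ?_ ?_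
  · rw [T.norm_map]; linarith [hΓn s]
  · rw [← map_neg]; congr 1
    simp only [hΓ, hX0, hX1]; module
  · rw [← map_sub, T.norm_map]; exact haw
  · intro s t h
    rw [← map_sub] at h
    have h1 : Φ (X s) = Φ (X t + w) := by
      rw [he _ w hw, ← T.injective h]; simp only [hΓ]; abel
    have h2 := hi h1
    have h3 : w = (cl s - cl t) • (y' - x) := by
      have : w = X s - X t := by rw [h2]; abel
      rw [this]; simp only [hX]; module
    rw [h3, norm_smul] at hwn
    have h4 : ‖cl s - cl t‖ ≤ 1 := by
      rw [Real.norm_eq_abs, abs_le]; constructor <;> linarith [hcl0 s, hcl1 s, hcl0 t, hcl1 t]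
    nlinarith [norm_nonneg (y' - x), norm_nonneg (cl s - cl t)]

lemma seg_approx (K : Set R2) (C : ℝ) (hC : 0 ≤ C)
    (hK : ∀ a ∈ K, ∀ b ∈ K, ∃ k ∈ K, ‖k - (1 / 2 : ℝ) • (a + b)‖ ≤ C) (j : ℕ) :
    ∀ a ∈ K, ∀ b ∈ K, ∀ c ∈ segment ℝ a b, ∃ k ∈ K, ‖c - k‖ ≤ ‖a - b‖ / 2 ^ j + 2 * j * C := by
  induction j with
  | zero =>
    intro a ha b hb c hc
    rw [segment_eq_image'] at hc
    obtain ⟨θ, ⟨h0, h1⟩, rfl⟩ := hc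
    refine ⟨a, ha, ?_⟩
    simp only [add_sub_cancel_left, norm_smul, Real.norm_eq_abs, abs_of_nonneg h0, pow_zero, div_one,
      CharP.cast_eq_zero, mul_zero, zero_mul, add_zero]
    rw [norm_sub_rev a b]
    nlinarith [norm_nonneg (b - a)]
  | succ j ih =>
    have key : ∀ a ∈ K, ∀ b ∈ K, ∀ θ : ℝ, 0 ≤ θ → θ ≤ 1 / 2 →
        ∃ k ∈ K, ‖(a + θ • (b - a)) - k‖ ≤ ‖a - b‖ / 2 ^ (j + 1) + 2 * (j + 1 : ℕ) * C := by
      intro a ha b hb θ h0 h1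
      obtain ⟨m, hm, hmC⟩ := hK a ha b hb
      obtain ⟨k, hk, hkC⟩ := ih a ha m hm (a + (2 * θ) • (m - a)) (by
        rw [segment_eq_image']; exact ⟨2 * θ, ⟨by linarith, by linarith⟩, rfl⟩)
      refine ⟨k, hk, ?_⟩
      have e1 : (a + θ • (b - a)) - k = (a + (2 * θ) • (m - a) - k)
          - (2 * θ) • (m - (1 / 2 : ℝ) • (a + b)) := by module
      have e2 : a - m = (1 / 2 : ℝ) • (a - b) - (m - (1 / 2 : ℝ) • (a + b)) := by module
      have h2 : ‖a - m‖ ≤ ‖a - b‖ / 2 + C := by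
        rw [e2]
        refine (norm_sub_le _ _).trans ?_
        rw [norm_smul, Real.norm_eq_abs, abs_of_pos (by norm_num : (0 : ℝ) < 1 / 2)]; linarith
      have h3 : ‖(2 * θ) • (m - (1 / 2 : ℝ) • (a + b))‖ ≤ C := by
        rw [norm_smul, Real.norm_eq_abs, abs_of_nonneg (by linarith)]
        nlinarith [norm_nonneg (m - (1 / 2 : ℝ) • (a + b))]
      have h4 : (‖a - b‖ / 2 + C) / 2 ^ j ≤ ‖a - b‖ / 2 ^ (j + 1) + C := by
        rw [add_div, pow_succ, div_div, mul_comm 2]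
        have : C / 2 ^ j ≤ C := div_le_self hC (one_le_pow₀ (by norm_num))
        linarith
      have h5 : ‖a - m‖ / 2 ^ j ≤ (‖a - b‖ / 2 + C) / 2 ^ j := by gcongr
      rw [e1]
      refine (norm_sub_le _ _).trans ?_
      push_cast
      linarith
    intro a ha b hb c hc
    rw [segment_eq_image'] at hc
    obtain ⟨θ, ⟨h0, h1⟩, rfl⟩ := hc
    rcases le_total θ (1 / 2) with h | h
    · exact key a ha b hb θ h0 h
    · obtain ⟨k, hk, hkC⟩ := key b hb a ha (1 - θ) (by linarith) (by linarith)
      refine ⟨k, hk, ?_⟩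
      rw [norm_sub_rev a b]
      convert hkC using 3
      module

lemma hull_approx (K : Set R2) (E : ℝ) (hE : 0 ≤ E)
    (hK : ∀ a ∈ K, ∀ b ∈ K, ∀ c ∈ segment ℝ a b, ∃ k ∈ K, ‖c - k‖ ≤ E) :
    ∀ c ∈ convexHull ℝ K, ∃ k ∈ K, ‖c - k‖ ≤ 3 * E := by
  have key : ∀ t : Finset R2, (t : Set R2) ⊆ K → ∀ c ∈ convexHull ℝ (t : Set R2),
      ∃ k ∈ K, ‖c - k‖ ≤ t.card * E := by
    classical
    intro t
    induction t using Finset.induction_on with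
    | empty => intro _ c hc; simp at hc
    | insert a s has ih =>
      intro hs c hc
      rw [Finset.coe_insert] at hs hc
      have haK : a ∈ K := hs (mem_insert _ _)
      rcases s.eq_empty_or_nonempty with rfl | hne
      · simp at hc
        subst hc
        exact ⟨c, haK, by simp; exact hE⟩
      · rw [convexHull_insert (by simpa using hne)] at hc
        simp only [convexJoin_singleton_left, mem_iUnion] at hc
        obtain ⟨e, he, hc⟩ := hc
        obtain ⟨k, hk, hkE⟩ := ih ((subset_insert _ _).trans hs) e he
        rw [segment_eq_image'] at hc
        obtain ⟨θ, ⟨h0, h1⟩, rfl⟩ := hc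
        obtain ⟨k', hk', hkE'⟩ := hK a haK k hk (a + θ • (k - a))
          (by rw [segment_eq_image']; exact ⟨θ, ⟨h0, h1⟩, rfl⟩)
        refine ⟨k', hk', ?_⟩
        have e1 : a + θ • (e - a) - k' = (a + θ • (k - a) - k') + θ • (e - k) := by module
        rw [e1, Finset.card_insert_of_notMem has]
        refine (norm_add_le _ _).trans ?_
        have : ‖θ • (e - k)‖ ≤ s.card * E := by
          rw [norm_smul, Real.norm_eq_abs, abs_of_nonneg h0]
          nlinarith [norm_nonneg (e - k)]
        push_cast; linarith
  intro c hc
  rw [convexHull_eq_union] at hc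
  simp only [mem_iUnion] at hc
  obtain ⟨t, ht, hai, hct⟩ := hc
  obtain ⟨k, hk, hkE⟩ := key t ht c hct
  refine ⟨k, hk, hkE.trans ?_⟩
  have h1 := hai.card_le_finrank_succ
  have h2 : Module.finrank ℝ (vectorSpan ℝ (Set.range ((↑) : t → R2))) ≤ 2 := by
    refine (Submodule.finrank_le _).trans ?_
    simp
  have h3 : (t.card : ℝ) ≤ 3 := by
    rw [Fintype.card_coe] at h1
    exact_mod_cast (by omega : t.card ≤ 3)
  exact mul_le_mul_of_nonneg_right h3 hE

lemma disp_bdd (F : R2 → R2) (hc : Continuous F)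
    (he : ∀ x : R2, ∀ w ∈ intLattice, F (x + w) = F x + w) :
    ∃ M, 0 ≤ M ∧ ∀ z, ‖F z - z‖ ≤ M := by
  obtain ⟨M, hM⟩ := (isCompact_closedBall (0 : R2) 1).exists_bound_of_continuousOn
    (f := fun z => F z - z) (by fun_prop)
  have key : ∀ z, ‖F z - z‖ ≤ M := by
    intro z
    obtain ⟨w, hw, hzw⟩ := exists_lattice_near z
    have := hM (z - w) (by simpa using hzw)
    have h2 := he (z - w) w hw
    rw [sub_add_cancel] at h2
    have h3 : F z - z = F (z - w) - (z - w) := by rw [h2]; abel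
    rw [h3]; exact this
  exact ⟨M, (norm_nonneg _).trans (key 0), key⟩

lemma iter_equiv (F : R2 → R2)
    (he : ∀ x : R2, ∀ w ∈ intLattice, F (x + w) = F x + w) (n : ℕ) :
    ∀ x : R2, ∀ w ∈ intLattice, F^[n] (x + w) = F^[n] x + w := by
  induction n with
  | zero => intro x w _; rfl
  | succ n ih => intro x w hw; rw [Function.iterate_succ_apply', Function.iterate_succ_apply',
      ih x w hw, he _ w hw]

lemma iter_bdd (F : R2 → R2) (M : ℝ) (hM : ∀ z, ‖F z - z‖ ≤ M) (n : ℕ) (z : R2) :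
    ‖F^[n] z - z‖ ≤ n * M := by
  induction n with
  | zero => simp
  | succ n ih =>
    rw [Function.iterate_succ_apply']
    have := norm_add_le (F (F^[n] z) - F^[n] z) (F^[n] z - z)
    rw [sub_add_sub_cancel] at this
    push_cast
    linarith [hM (F^[n] z)]

lemma disp_hull (F : R2 → R2) (M : ℝ) (hM0 : 0 ≤ M) (hM : ∀ z, ‖F z - z‖ ≤ M) (n : ℕ) (hn : 0 < n) :
    ∀ N : ℕ, ∀ z, ∃ p ∈ convexHull ℝ (range (fun z => F^[n] z - z)),
      ‖(n : ℝ) • (F^[N] z - z) - (N : ℝ) • p‖ ≤ 2 * n ^ 2 * M := by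
  intro N
  induction N using Nat.strong_induction_on with
  | _ N ih =>
  intro z
  rcases lt_or_ge N n with h | h
  · refine ⟨F^[n] z - z, subset_convexHull _ _ ⟨z, rfl⟩, ?_⟩
    have h1 := iter_bdd F M hM N z
    have h2 := iter_bdd F M hM n z
    have h3 : (N : ℝ) ≤ n := by exact_mod_cast h.le
    have h4 : (0 : ℝ) ≤ N := by positivity
    refine (norm_sub_le _ _).trans ?_
    rw [norm_smul, norm_smul, Real.norm_natCast, Real.norm_natCast]
    have h5 : (n : ℝ) * ‖F^[N] z - z‖ ≤ n * (n * M) := by gcongr; exact h1.trans (by gcongr)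
    have h6 : (N : ℝ) * ‖F^[n] z - z‖ ≤ n * (n * M) := by gcongr
    linarith
  · obtain ⟨q, rfl⟩ := Nat.exists_eq_add_of_le' h
    obtain ⟨p, hp, hpE⟩ := ih q (by omega) (F^[n] z)
    have hpos : (0 : ℝ) < q + n := by positivity
    refine ⟨((q : ℝ) / (q + n)) • p + ((n : ℝ) / (q + n)) • (F^[n] z - z), ?_, ?_⟩
    · refine (convex_convexHull ℝ _) hp (subset_convexHull _ _ ⟨z, rfl⟩) (by positivity)
        (by positivity) ?_
      field_simp
    · convert hpE using 2
      rw [Function.iterate_add_apply]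
      push_cast
      rw [smul_add, smul_smul, smul_smul, mul_div_cancel₀ _ hpos.ne', mul_div_cancel₀ _ hpos.ne']
      module

lemma rot_mem_hull (F : R2 ≃ₜ R2) (M : ℝ) (hM0 : 0 ≤ M) (hM : ∀ z, ‖F z - z‖ ≤ M) (n : ℕ) (hn : 0 < n)
    (v : R2) (hv : v ∈ rotSet F) :
    (n : ℝ) • v ∈ closure (convexHull ℝ (range (fun z => (⇑F)^[n] z - z))) := by
  obtain ⟨z, N, hN, hlim⟩ := hv
  choose p hp hpE using fun k => disp_hull F M hM0 hM n hn (N k) (z k)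
  refine mem_closure_of_tendsto (f := p) (b := atTop) ?_ (Eventually.of_forall hp)
  have h1 := hlim.const_smul (n : ℝ)
  have hNr : Tendsto (fun k => (N k : ℝ)) atTop atTop := tendsto_natCast_atTop_atTop.comp hN
  have h2 : Tendsto (fun k => 2 * n ^ 2 * M * ((N k : ℝ))⁻¹) atTop (𝓝 0) := by
    simpa using (tendsto_inv_atTop_zero.comp hNr).const_mul (2 * n ^ 2 * M)
  have h3 : Tendsto (fun k => (n : ℝ) • (N k : ℝ)⁻¹ • ((⇑F)^[N k] (z k) - z k) - p k) atTop (𝓝 0) := by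
    refine squeeze_zero_norm' ?_ h2
    filter_upwards [hNr.eventually_gt_atTop 0] with k hk
    have e : (n : ℝ) • (N k : ℝ)⁻¹ • ((⇑F)^[N k] (z k) - z k) - p k =
      (N k : ℝ)⁻¹ • ((n : ℝ) • ((⇑F)^[N k] (z k) - z k) - (N k : ℝ) • p k) := by
      rw [smul_sub _ _ ((N k : ℝ) • p k), inv_smul_smul₀ hk.ne', smul_comm]
    rw [e, norm_smul, norm_inv, Real.norm_natCast, mul_comm]
    gcongr
    exact hpE k
  simpa using h1.sub h3

lemma rotSet_of_approx (F : R2 ≃ₜ R2) (c : R2)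
    (h : ∀ l : ℕ, ∃ n ≥ l, ∃ z, ‖(n : ℝ)⁻¹ • ((⇑F)^[n] z - z) - c‖ ≤ 1 / ((l : ℝ) + 1)) :
    c ∈ rotSet F := by
  choose n hn z hz using h
  refine ⟨z, n, tendsto_atTop_mono hn tendsto_id, ?_⟩
  rw [tendsto_iff_norm_sub_tendsto_zero]
  exact squeeze_zero (fun _ => norm_nonneg _) hz tendsto_one_div_add_atTop_nhds_zero_nat

lemma rotSet_convex (F : R2 ≃ₜ R2)
    (he : ∀ x : R2, ∀ w ∈ intLattice, F (x + w) = F x + w) : Convex ℝ (rotSet F) := by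
  obtain ⟨M, hM0, hM⟩ := disp_bdd F F.continuous he
  intro v1 h1 v2 h2 α β hα hβ hαβ
  set c := α • v1 + β • v2 with hc
  apply rotSet_of_approx
  intro l
  set η : ℝ := 1 / ((l : ℝ) + 1) with hη
  have hηp : 0 < η := by positivity
  obtain ⟨j, hj⟩ := pow_unbounded_of_one_lt (12 * M / η) (by norm_num : (1 : ℝ) < 2)
  obtain ⟨n0, hn0⟩ := exists_nat_gt ((1 + 3 * (2 * j * 5)) / (η / 2))
  set n := max (max n0 l) 1 with hn
  have hn1 : 0 < n := lt_of_lt_of_le Nat.one_pos (le_max_right _ _)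
  have hnl : l ≤ n := (le_max_right _ _).trans (le_max_left _ _)
  have hnn0 : (n0 : ℝ) ≤ n := by exact_mod_cast (le_max_left n0 l).trans (le_max_left _ _)
  have hnr : (0 : ℝ) < n := by exact_mod_cast hn1
  refine ⟨n, hnl, ?_⟩
  set K := range (fun z => (⇑F)^[n] z - z) with hK
  have hcl : (n : ℝ) • c ∈ closure (convexHull ℝ K) := by
    have := (convex_convexHull ℝ K).closure (rot_mem_hull F M hM0 hM n hn1 v1 h1)
      (rot_mem_hull F M hM0 hM n hn1 v2 h2) hα hβ hαβ
    convert this using 1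
    rw [hc]; module
  obtain ⟨p, hp, hpc⟩ := Metric.mem_closure_iff.1 hcl 1 one_pos
  have hmid : ∀ a ∈ K, ∀ b ∈ K, ∃ k ∈ K, ‖k - (1 / 2 : ℝ) • (a + b)‖ ≤ 5 := by
    rintro _ ⟨x, rfl⟩ _ ⟨y, rfl⟩
    obtain ⟨z, hz⟩ := midpoint_approx ((⇑F)^[n]) (F.continuous.iterate n) (F.injective.iterate n)
      (iter_equiv F he n) x y
    exact ⟨_, ⟨z, rfl⟩, hz⟩
  have hbd : ∀ a ∈ K, ‖a‖ ≤ n * M := by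
    rintro _ ⟨x, rfl⟩
    exact iter_bdd F M hM n x
  obtain ⟨k, ⟨z, rfl⟩, hk⟩ := hull_approx K (2 * (n * M) / 2 ^ j + 2 * j * 5) (by positivity) (by
    intro a ha b hb c hc
    obtain ⟨k, hk, hkE⟩ := seg_approx K 5 (by norm_num) hmid j a ha b hb c hc
    refine ⟨k, hk, hkE.trans ?_⟩
    gcongr
    linarith [norm_sub_le a b, hbd a ha, hbd b hb]) p hp
  refine ⟨z, ?_⟩
  have e : (n : ℝ)⁻¹ • ((⇑F)^[n] z - z) - c = (n : ℝ)⁻¹ • (((⇑F)^[n] z - z) - (n : ℝ) • c) := by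
    rw [smul_sub _ _ ((n : ℝ) • c), inv_smul_smul₀ hnr.ne']
  rw [e, norm_smul, norm_inv, Real.norm_natCast, inv_mul_le_iff₀ hnr]
  have h3 : ‖((⇑F)^[n] z - z) - (n : ℝ) • c‖ ≤ ‖p - ((⇑F)^[n] z - z)‖ + dist ((n : ℝ) • c) p := by
    rw [← dist_eq_norm, ← dist_eq_norm, dist_comm _ p]
    exact dist_triangle_left _ _ _
  have h4 : 6 * (n * M) / 2 ^ j ≤ n * (η / 2) := by
    rw [div_le_iff₀ (by positivity)]
    rw [div_lt_iff₀ hηp] at hj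
    nlinarith
  have h5 : 1 + 3 * (2 * j * 5) ≤ n * (η / 2) := by
    rw [div_lt_iff₀ (by positivity)] at hn0
    nlinarith
  have h6 : 3 * (2 * (n * M) / 2 ^ j + 2 * j * 5) = 6 * (n * M) / 2 ^ j + 3 * (2 * j * 5) := by ring
  linarith

lemma lat_closed : IsClosed (intLattice : Set R2) := by
  have : (intLattice : Set R2) = ⋂ i : Fin 2, (fun v : R2 => v i) ⁻¹' (range ((↑) : ℤ → ℝ)) := by
    ext v
    simp only [mem_iInter, mem_preimage, mem_range]
    constructor
    · intro h i; obtain ⟨n, hn⟩ := h i; exact ⟨n, hn.symm⟩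
    · intro h i; obtain ⟨n, hn⟩ := h i; exact ⟨n, hn.symm⟩
  rw [this]
  refine isClosed_iInter fun i => IsClosed.preimage (by fun_prop) ?_
  exact Int.isClosedEmbedding_coe_real.isClosed_range

lemma lat_countable : (intLattice : Set R2).Countable := by
  refine (countable_range (fun p : ℤ × ℤ => (!₂[(p.1 : ℝ), (p.2 : ℝ)] : R2))).mono ?_
  intro v hv
  obtain ⟨a, ha⟩ := hv 0
  obtain ⟨b, hb⟩ := hv 1
  refine ⟨(a, b), ?_⟩
  ext i
  fin_cases i
  · simpa using ha.symm
  · simpa using hb.symm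

def latN (z : R2) : ℝ := infDist z (intLattice : Set R2)

lemma lat_ne : (intLattice : Set R2).Nonempty := ⟨0, intLattice.zero_mem⟩

lemma latN_add (z w : R2) (hw : w ∈ intLattice) : latN (z + w) = latN z := by
  have key : ∀ z w : R2, w ∈ intLattice → latN (z + w) ≤ latN z := by
    intro z w hw
    refine (le_infDist lat_ne).2 fun y hy => ?_
    refine (infDist_le_dist_of_mem (intLattice.add_mem hy hw)).trans ?_
    simp
  refine le_antisymm (key z w hw) ?_
  have := key (z + w) (-w) (intLattice.neg_mem hw)
  simpa using this

lemma latN_neg (z : R2) : latN (-z) = latN z := by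
  have key : ∀ z : R2, latN (-z) ≤ latN z := by
    intro z
    refine (le_infDist lat_ne).2 fun y hy => ?_
    refine (infDist_le_dist_of_mem (intLattice.neg_mem hy)).trans ?_
    rw [dist_neg_neg]
  refine le_antisymm (key z) ?_
  simpa using key (-z)

lemma latN_lip (z z' : R2) : |latN z - latN z'| ≤ ‖z - z'‖ := by
  have := (lipschitz_infDist_pt (intLattice : Set R2)).dist_le_mul z z'
  simpa [Real.dist_eq, dist_eq_norm, latN] using this

lemma latN_zero : latN 0 = 0 := infDist_zero_of_mem intLattice.zero_mem

lemma latN_nonneg (z : R2) : 0 ≤ latN z := infDist_nonneg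

lemma latN_pos (z : R2) (hz : z ∉ intLattice) : 0 < latN z :=
  (lat_closed.notMem_iff_infDist_pos lat_ne).1 hz

lemma latN_cont : Continuous latN := continuous_infDist_pt _

lemma latN_sub_le (z p q : R2) : latN (p - q) ≤ latN (z - p) + latN (z - q) := by
  refine le_of_forall_pos_le_add fun ε hε => ?_
  obtain ⟨a, ha, ha'⟩ := (infDist_lt_iff (x := z - p) (r := latN (z - p) + ε / 2) lat_ne).1
    (by show latN _ < _; linarith)
  obtain ⟨b, hb, hb'⟩ := (infDist_lt_iff (x := z - q) (r := latN (z - q) + ε / 2) lat_ne).1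
    (by show latN _ < _; linarith)
  have h1 : latN (p - q) ≤ dist (p - q) (b - a) := infDist_le_dist_of_mem (intLattice.sub_mem hb ha)
  have h2 : dist (p - q) (b - a) ≤ dist (z - p) a + dist (z - q) b := by
    rw [dist_eq_norm, dist_eq_norm, dist_eq_norm, add_comm]
    refine le_trans (le_of_eq ?_) (norm_sub_le _ _)
    congr 1; abel
  linarith

def Equivar (F : R2 → R2) : Prop := ∀ x : R2, ∀ w ∈ intLattice, F (x + w) = F x + w

lemma bump_step (m : ℕ) (p v : ℕ → R2) (r κ : ℝ) (hr : 0 < r) (hκ : 0 ≤ κ)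
    (hv : ∀ i < m, ‖v i‖ ≤ κ) (hsep : ∀ i < m, ∀ j < i, 2 * r ≤ latN (p i - p j))
    (hm : m * κ < r) :
    ∃ H : R2 ≃ₜ R2, Equivar H ∧ (∀ i < m, H (p i) = p i + v i) ∧ ∀ z, ‖H z - z‖ ≤ κ := by
  have hsep' : ∀ i < m, ∀ j < m, i ≠ j → 2 * r ≤ latN (p i - p j) := by
    intro i hi j hj hij
    rcases lt_or_gt_of_ne hij with h | h
    · rw [← latN_neg, neg_sub]; exact hsep j hj i h
    · exact hsep i hi j h
  set b : ℕ → R2 → ℝ := fun i z => max 0 (1 - latN (z - p i) / r) with hb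
  have hb0 : ∀ i z, 0 ≤ b i z := fun i z => le_max_left _ _
  have hb1 : ∀ i z, b i z ≤ 1 := fun i z => max_le zero_le_one (by
    have := div_nonneg (latN_nonneg (z - p i)) hr.le; linarith)
  have hblip : ∀ i z z', |b i z - b i z'| ≤ ‖z - z'‖ / r := by
    intro i z z'
    refine (abs_max_sub_max_le_max _ _ _ _).trans ?_
    simp only [sub_self, abs_zero]
    refine max_le (by positivity) ?_
    rw [sub_sub_sub_cancel_left, ← sub_div, abs_div, abs_of_pos hr, abs_sub_comm]
    gcongr
    refine (latN_lip _ _).trans (le_of_eq ?_)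
    congr 1; abel
  have hbz : ∀ i z, r ≤ latN (z - p i) → b i z = 0 := by
    intro i z h
    have : 1 ≤ latN (z - p i) / r := by rwa [le_div_iff₀ hr, one_mul]
    exact max_eq_left (by linarith)
  set u : R2 → R2 := fun z => ∑ i ∈ Finset.range m, b i z • v i with hu
  have hulip : ∀ z z', ‖u z - u z'‖ ≤ (m * κ / r) * ‖z - z'‖ := by
    intro z z'
    simp only [hu]
    rw [← Finset.sum_sub_distrib]
    refine (norm_sum_le_of_le (f := fun i => b i z • v i - b i z' • v i)
      (n := fun _ => ‖z - z'‖ / r * κ) _ fun i hi => ?_).trans ?_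
    · rw [← sub_smul, norm_smul, Real.norm_eq_abs]
      exact mul_le_mul (hblip i z z') (hv i (Finset.mem_range.1 hi)) (norm_nonneg _) (by positivity)
    · rw [Finset.sum_const, Finset.card_range, nsmul_eq_mul]
      apply le_of_eq; ring
  have huper : ∀ z, ∀ w ∈ intLattice, u (z + w) = u z := by
    intro z w hw
    simp only [hu, hb]
    refine Finset.sum_congr rfl fun i _ => ?_
    rw [add_sub_right_comm, latN_add _ _ hw]
  have hubd : ∀ z, ‖u z‖ ≤ κ := by
    intro z
    by_cases h : ∃ i ∈ Finset.range m, latN (z - p i) < r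
    · obtain ⟨i, hi, hir⟩ := h
      have him := Finset.mem_range.1 hi
      have : u z = b i z • v i := by
        refine Finset.sum_eq_single i (fun j hj hji => ?_) (fun h => absurd hi h)
        rw [hbz j z, zero_smul]
        by_contra hc
        push Not at hc
        have := latN_sub_le z (p j) (p i)
        have := hsep' j (Finset.mem_range.1 hj) i him hji
        linarith
      rw [this, norm_smul, Real.norm_eq_abs, abs_of_nonneg (hb0 i z)]
      have := hv i him
      nlinarith [hb1 i z, norm_nonneg (v i), hb0 i z]
    · push Not at h
      have : u z = 0 := Finset.sum_eq_zero fun i hi => by rw [hbz i z (h i hi), zero_smul]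
      rw [this, norm_zero]; exact hκ
  have hupt : ∀ i < m, u (p i) = v i := by
    intro i him
    have : u (p i) = b i (p i) • v i := by
      refine Finset.sum_eq_single i (fun j hj hji => ?_) (fun h => absurd (Finset.mem_range.2 him) h)
      rw [hbz j (p i), zero_smul]
      have := hsep' i him j (Finset.mem_range.1 hj) (Ne.symm hji)
      linarith
    rw [this]
    simp [hb, latN_zero]
  obtain ⟨cN, hcN⟩ : ∃ cN : NNReal, (cN : ℝ) = m * κ / r :=
    ⟨Real.toNNReal (m * κ / r), Real.coe_toNNReal _ (by positivity)⟩
  have hA : ApproximatesLinearOn (fun z => z + u z)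
      ((ContinuousLinearEquiv.refl ℝ R2 : R2 ≃L[ℝ] R2) : R2 →L[ℝ] R2) univ
      cN := by
    intro z _ z' _
    rw [hcN]
    refine le_trans (le_of_eq ?_) (hulip z z')
    congr 1
    simp
    abel
  have hcc : Subsingleton R2 ∨ cN <
      ‖((ContinuousLinearEquiv.refl ℝ R2).symm : R2 →L[ℝ] R2)‖₊⁻¹ := by
    right
    have : ‖((ContinuousLinearEquiv.refl ℝ R2).symm : R2 →L[ℝ] R2)‖₊ = 1 := by
      apply NNReal.eq
      exact ContinuousLinearMap.norm_id
    rw [this, inv_one, ← NNReal.coe_lt_coe]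
    show (cN : ℝ) < 1
    rw [hcN]
    rwa [div_lt_one hr]
  have hH : ∀ z, hA.toHomeomorph _ hcc z = z + u z := fun z => rfl
  refine ⟨hA.toHomeomorph _ hcc, ?_, ?_, ?_⟩
  · intro x w hw
    rw [hH, hH, huper x w hw]; abel
  · intro i hi
    rw [hH, hupt i hi]
  · intro z
    rw [hH, add_sub_cancel_left]; exact hubd z

lemma push_points (m : ℕ) (y c : ℕ → R2) (ε : ℝ) (hε : 0 ≤ ε) (hd : ∀ i < m, ‖c i - y i‖ ≤ ε)
    (hsep : ∀ i < m, ∀ j < i, ∀ t ∈ Icc (0 : ℝ) 1,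
      (y i + t • (c i - y i)) - (y j + t • (c j - y j)) ∉ intLattice) :
    ∃ H : R2 ≃ₜ R2, Equivar H ∧ (∀ i < m, H (y i) = c i) ∧ ∀ z, ‖H z - z‖ ≤ ε := by
  have hr : ∀ᶠ r in 𝓝[>] (0 : ℝ), ∀ i ∈ Finset.range m, ∀ j ∈ Finset.range i, ∀ t ∈ Icc (0 : ℝ) 1,
      2 * r ≤ latN ((y i + t • (c i - y i)) - (y j + t • (c j - y j))) := by
    rw [Filter.eventually_all_finset]
    intro i hi
    rw [Filter.eventually_all_finset]
    intro j hj
    obtain ⟨t0, ht0, hmin⟩ := isCompact_Icc.exists_isMinOn (nonempty_Icc.2 zero_le_one)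
      (f := fun t : ℝ => latN ((y i + t • (c i - y i)) - (y j + t • (c j - y j)))) (s := Icc (0 : ℝ) 1)
      (latN_cont.comp (by fun_prop)).continuousOn
    have hpos := latN_pos _ (hsep i (Finset.mem_range.1 hi) j (Finset.mem_range.1 hj) t0 ht0)
    have : Ioo (0 : ℝ) (latN ((y i + t0 • (c i - y i)) - (y j + t0 • (c j - y j))) / 2) ∈ 𝓝[>] (0 : ℝ) :=
      Ioo_mem_nhdsGT (by linarith)
    filter_upwards [this] with r hr t ht
    have := hmin ht
    change latN _ ≤ latN _ at this
    linarith [hr.2]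
  obtain ⟨r, hr, hr0⟩ := (hr.and self_mem_nhdsWithin).exists
  have hr0 : 0 < r := hr0
  obtain ⟨n0, hn0⟩ := exists_nat_gt (m * ε / r)
  set n := n0 + 1 with hn
  have hnr : (0 : ℝ) < n := by positivity
  have hnn : m * ε / r < n := by rw [hn]; push_cast; linarith
  have key : ∀ k ≤ n, ∃ H : R2 ≃ₜ R2, Equivar H ∧
      (∀ i < m, H (y i) = y i + ((k : ℝ) / n) • (c i - y i)) ∧ ∀ z, ‖H z - z‖ ≤ k * (ε / n) := by
    intro k
    induction k with
    | zero =>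
      intro _
      exact ⟨Homeomorph.refl _, fun x w _ => rfl, fun i _ => by simp, fun z => by simp⟩
    | succ k ih =>
      intro hk
      obtain ⟨H, he, hp, hb⟩ := ih (by omega)
      have hkn : (k : ℝ) / n ∈ Icc (0 : ℝ) 1 :=
        ⟨by positivity, by rw [div_le_one hnr]; exact_mod_cast (by omega : k ≤ n)⟩
      obtain ⟨R, Re, Rp, Rb⟩ := bump_step m (fun i => y i + ((k : ℝ) / n) • (c i - y i))
        (fun i => (1 / (n : ℝ)) • (c i - y i)) r (ε / n) hr0 (by positivity)
        (fun i hi => by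
          rw [norm_smul, Real.norm_eq_abs, abs_of_pos (by positivity), one_div, inv_mul_eq_div]
          gcongr
          exact hd i hi)
        (fun i hi j hj => hr i (Finset.mem_range.2 hi) j (Finset.mem_range.2 hj) _ hkn)
        (by
          rw [div_lt_iff₀ hr0] at hnn
          rw [mul_div_assoc', div_lt_iff₀ hnr]; linarith)
      refine ⟨H.trans R, ?_, ?_, ?_⟩
      · intro x w hw
        simp only [Homeomorph.trans_apply]
        rw [he x w hw, Re _ w hw]
      · intro i hi
        simp only [Homeomorph.trans_apply]
        rw [hp i hi, Rp i hi, add_assoc, ← add_smul]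
        push_cast; rw [add_div]
      · intro z
        simp only [Homeomorph.trans_apply]
        have h1 := Rb (H z)
        have h2 := hb z
        have h3 := norm_add_le (R (H z) - H z) (H z - z)
        rw [sub_add_sub_cancel] at h3
        push_cast
        linarith
  obtain ⟨H, he, hp, hb⟩ := key n le_rfl
  refine ⟨H, he, fun i hi => ?_, fun z => ?_⟩
  · rw [hp i hi, div_self hnr.ne', one_smul]; abel
  · have := hb z
    rwa [mul_div_cancel₀ _ hnr.ne'] at this

lemma exists_down (G : R2 ≃ₜ R2) (he : Equivar G) : ∃ g : T2 ≃ₜ T2, IsLift g G := by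
  have hs : Equivar G.symm := by
    intro x w hw
    apply G.injective
    rw [he _ w hw]; simp
  have key : ∀ (A : R2 → R2), Equivar A → ∀ a b : R2,
      (QuotientAddGroup.leftRel intLattice) a b → (QuotientAddGroup.leftRel intLattice) (A a) (A b) := by
    intro A hA a b hab
    rw [QuotientAddGroup.leftRel_apply] at hab ⊢
    have : b = a + (-a + b) := by abel
    rw [this, hA _ _ hab]
    simpa using hab
  let g1 : T2 → T2 := Quotient.map G (key G he)
  let g2 : T2 → T2 := Quotient.map G.symm (key G.symm hs)
  have hc : ∀ (A : R2 → R2) (hA : Equivar A), Continuous A →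
      Continuous (Quotient.map A (key A hA) : T2 → T2) := by
    intro A hA hc
    exact Continuous.quotient_lift (continuous_quotient_mk'.comp hc) _
  refine ⟨⟨⟨g1, g2, ?_, ?_⟩, hc _ he G.continuous, hc _ hs G.symm.continuous⟩, ?_, he⟩
  · intro x
    induction x using Quotient.inductionOn with
    | _ a => exact congrArg pr (G.symm_apply_apply a)
  · intro x
    induction x using Quotient.inductionOn with
    | _ a => exact congrArg pr (G.apply_symm_apply a)
  · intro x; rfl

lemma closed_loop_mem (F H : R2 ≃ₜ R2) (δ s : ℝ) (hs : s < δ) (hF : Equivar F) (hH : Equivar H)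
    (hst : UpperStable Homeo0 F δ) (hb : ∀ z, ‖H z - z‖ ≤ s) (x : ℕ → R2) (m : ℕ) (hm : 0 < m)
    (w : R2) (hw : w ∈ intLattice) (hx : ∀ i < m, H (F (x i)) = x (i + 1)) (hxm : x m = x 0 + w) :
    (1 / (m : ℝ)) • w ∈ rotSet F := by
  have hG : Equivar (F.trans H) := by
    intro z u hu
    simp only [Homeomorph.trans_apply]
    rw [hF z u hu, hH _ u hu]
  obtain ⟨g, hg⟩ := exists_down (F.trans H) hG
  refine hst g ⟨_, hg⟩ (F.trans H) hg ?_ ?_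
  · refine lt_of_le_of_lt (ciSup_le fun z => ?_) hs
    rw [dist_comm, dist_eq_norm]
    exact hb (F z)
  · have h1 : ∀ i ≤ m, (⇑(F.trans H))^[i] (x 0) = x i := by
      intro i
      induction i with
      | zero => intro _; rfl
      | succ i ih =>
        intro hi
        rw [Function.iterate_succ_apply', ih (by omega)]
        exact hx i (by omega)
    have h2 : ∀ q : ℕ, (⇑(F.trans H))^[m * q] (x 0) = x 0 + (q : ℝ) • w ∧ (q : ℝ) • w ∈ intLattice := by
      intro q
      induction q with
      | zero => simp
      | succ q ih =>
        have e : ((q + 1 : ℕ) : ℝ) • w = w + (q : ℝ) • w := by push_cast; module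
        refine ⟨?_, ?_⟩
        · rw [Nat.mul_succ, add_comm, Function.iterate_add_apply, ih.1,
            iter_equiv _ hG m _ _ ih.2, h1 m le_rfl, hxm, e, add_assoc]
        · rw [e]; exact intLattice.add_mem hw ih.2
    apply rotSet_of_approx
    intro l
    refine ⟨m * (l + 1), ?_, x 0, ?_⟩
    · nlinarith
    · rw [(h2 (l + 1)).1, add_sub_cancel_left, smul_smul]
      have : ((m * (l + 1) : ℕ) : ℝ)⁻¹ * ((l + 1 : ℕ) : ℝ) = 1 / m := by
        have : (m : ℝ) ≠ 0 := by positivity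
        push_cast
        field_simp
      rw [this, sub_self, norm_zero]
      positivity

lemma generic_choice (m : ℕ) (U : ℕ → Set R2) (x : ℕ → R2) (hU : ∀ i, U i ∈ 𝓝 (x i))
    (B : ℕ → ℕ → Set R2) (hB : ∀ i j, volume (B i j) = 0) :
    ∃ x' : ℕ → R2, ∀ i < m, x' i ∈ U i ∧ ∀ j < i, x' i - x' j ∉ B i j := by
  induction m with
  | zero => exact ⟨x, by simp⟩
  | succ m ih =>
    obtain ⟨x', hx'⟩ := ih
    set Bad : Set R2 := ⋃ j : ℕ, (fun z => z - x' j) ⁻¹' (B m j) with hBad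
    have hnull : volume Bad = 0 := by
      rw [hBad, measure_iUnion_null_iff]
      intro j
      exact (measurePreserving_sub_right volume (x' j)).quasiMeasurePreserving.preimage_null (hB m j)
    obtain ⟨a, haU, haB⟩ : ∃ a ∈ U m, a ∉ Bad := by
      by_contra hc
      push Not at hc
      have h1 : volume (U m) = 0 := measure_mono_null hc hnull
      exact (Measure.measure_pos_of_mem_nhds volume (hU m)).ne' h1
    refine ⟨Function.update x' m a, fun i hi => ?_⟩
    rcases Nat.lt_succ_iff_lt_or_eq.1 hi with h | rfl
    · rw [Function.update_of_ne h.ne]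
      refine ⟨(hx' i h).1, fun j hj => ?_⟩
      rw [Function.update_of_ne (by omega)]
      exact (hx' i h).2 j hj
    · rw [Function.update_self]
      refine ⟨haU, fun j hj => ?_⟩
      rw [Function.update_of_ne hj.ne]
      intro h
      exact haB (mem_iUnion.2 ⟨j, h⟩)

lemma line_null (p q : R2) : volume ((affineSpan ℝ {p, q} : AffineSubspace ℝ R2) : Set R2) = 0 := by
  apply Measure.addHaar_affineSubspace
  intro h
  have h1 : (affineSpan ℝ {p, q} : AffineSubspace ℝ R2).direction = ⊤ := by
    rw [h]; exact AffineSubspace.direction_top ℝ R2 R2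
  rw [direction_affineSpan] at h1
  have h2 : Module.finrank ℝ (vectorSpan ℝ ({p, q} : Set R2)) = Module.finrank ℝ (⊤ : Submodule ℝ R2) := by
    rw [h1]
  simp only [finrank_top, finrank_euclideanSpace, Fintype.card_fin] at h2
  have h3 := finrank_vectorSpan_insert_le_set ℝ ({q} : Set R2) p
  rw [h2, vectorSpan_singleton] at h3
  simp at h3

def badSet (e : R2) : Set R2 := ⋃ l ∈ (intLattice : Set R2), (affineSpan ℝ {e, l} : AffineSubspace ℝ R2)

lemma badSet_null (e : R2) : volume (badSet e) = 0 := by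
  rw [badSet, measure_biUnion_null_iff lat_countable]
  intro l _
  exact line_null e l

lemma not_bad (e d : R2) (he : e ∉ intLattice) (hd : d ∉ badSet e) (t : ℝ) :
    e + t • (d - e) ∉ intLattice := by
  intro h
  rcases eq_or_ne t 0 with rfl | ht
  · simp at h; exact he h
  · apply hd
    refine mem_biUnion h ?_
    have := AffineMap.lineMap_mem_affineSpan_pair (k := ℝ) t⁻¹ e (e + t • (d - e))
    rw [AffineMap.lineMap_apply_module', add_sub_cancel_left, smul_smul, inv_mul_cancel₀ ht,
      one_smul, sub_add_cancel] at this
    exact this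

lemma loop_mem (F : R2 ≃ₜ R2) (δ s : ℝ) (hs : s < δ) (hF : Equivar F)
    (hst : UpperStable Homeo0 F δ) (x : ℕ → R2) (m : ℕ) (hm : 0 < m)
    (w : R2) (hw : w ∈ intLattice) (hx : ∀ i < m, ‖F (x i) - x (i + 1)‖ < s) (hxm : x m = x 0 + w) :
    (1 / (m : ℝ)) • w ∈ rotSet F := by
  have hζ : ∀ᶠ ζ in 𝓝[>] (0 : ℝ), ∀ i ∈ Finset.range m, ‖F (x i) - x (i + 1)‖ + 2 * ζ < s := by
    rw [Filter.eventually_all_finset]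
    intro i hi
    have := hx i (Finset.mem_range.1 hi)
    filter_upwards [Ioo_mem_nhdsGT (show (0 : ℝ) < (s - ‖F (x i) - x (i + 1)‖) / 2 by linarith)] with r hr
    linarith [hr.2]
  obtain ⟨ζ, hζ, hζ0⟩ := (hζ.and self_mem_nhdsWithin).exists
  have hζ0 : 0 < ζ := hζ0
  have hs0 : 0 ≤ s := (norm_nonneg _).trans (hx 0 hm).le
  obtain ⟨x', hx'⟩ := generic_choice m (fun i => ball (x i) ζ ∩ F ⁻¹' (ball (F (x i)) ζ)) x
    (fun i => inter_mem (ball_mem_nhds _ hζ0)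
      (F.continuous.continuousAt.preimage_mem_nhds (ball_mem_nhds _ hζ0)))
    (fun _ _ => (intLattice : Set R2)) (fun _ _ => lat_countable.measure_zero _)
  have hdist : ∀ i < m, ∀ j < m, i ≠ j → x' i - x' j ∉ intLattice := by
    intro i hi j hj hij
    rcases lt_or_gt_of_ne hij with h | h
    · intro hc
      apply (hx' j hj).2 i h
      have := intLattice.neg_mem hc
      rwa [neg_sub] at this
    · exact (hx' i hi).2 j h
  set X : ℕ → R2 := fun i => if i + 1 < m then x' (i + 1) else x' 0 + w with hX
  set Y : ℕ → R2 := fun i => F (x' i) with hY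
  have hXd : ∀ i < m, ∀ j < i, X i - X j ∉ intLattice := by
    intro i hi j hj
    have e : X j = x' (j + 1) := by simp only [hX]; rw [if_pos (by omega)]
    rw [e]
    by_cases h : i + 1 < m
    · have e : X i = x' (i + 1) := by simp only [hX]; rw [if_pos h]
      rw [e]
      exact hdist _ h _ (by omega) (by omega)
    · have e : X i = x' 0 + w := by simp only [hX]; rw [if_neg h]
      rw [e]
      intro hc
      apply hdist 0 hm (j + 1) (by omega) (by omega)
      have := intLattice.sub_mem hc hw
      rwa [show x' 0 + w - x' (j + 1) - w = x' 0 - x' (j + 1) by abel] at this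
  have hYd : ∀ i < m, ∀ j < i, Y i - Y j ∉ intLattice := by
    intro i hi j hj hc
    apply hdist i hi j (by omega) (by omega)
    have h1 : F (x' i) = F (x' j + (Y i - Y j)) := by
      rw [hF _ _ hc]; simp only [hY]; abel
    have h2 := F.injective h1
    have h3 : x' i - x' j = Y i - Y j := by
      rw [sub_eq_iff_eq_add, add_comm]; exact h2
    rw [h3]; exact hc
  have hYX : ∀ i < m, ‖X i - Y i‖ < s := by
    intro i hi
    have h1 : ‖F (x' i) - F (x i)‖ < ζ := by
      have := (hx' i hi).1.2
      rwa [mem_preimage, mem_ball, dist_eq_norm] at this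
    have h2 : ‖X i - x (i + 1)‖ < ζ := by
      by_cases h : i + 1 < m
      · have e : X i = x' (i + 1) := by simp only [hX]; rw [if_pos h]
        have := (hx' _ h).1.1
        rwa [mem_ball, dist_eq_norm, ← e] at this
      · have e : X i = x' 0 + w := by simp only [hX]; rw [if_neg h]
        have := (hx' 0 hm).1.1
        rw [mem_ball, dist_eq_norm] at this
        have hi : i + 1 = m := by omega
        rw [e, hi, hxm, add_sub_add_right_eq_sub]; exact this
    have h3 := hζ i (Finset.mem_range.2 hi)
    have h4 : X i - Y i = (X i - x (i + 1)) - (F (x i) - x (i + 1)) - (F (x' i) - F (x i)) := by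
      simp only [hY]; abel
    rw [h4]
    have h5 := norm_sub_le ((X i - x (i + 1)) - (F (x i) - x (i + 1))) (F (x' i) - F (x i))
    have h6 := norm_sub_le (X i - x (i + 1)) (F (x i) - x (i + 1))
    linarith
  obtain ⟨ζ', hζ'⟩ : ∃ ζ', ζ' = (δ - s) / 4 := ⟨_, rfl⟩
  have hζ'0 : 0 < ζ' := by rw [hζ']; linarith
  obtain ⟨c, hc⟩ := generic_choice m (fun i => ball (X i) ζ') X (fun i => ball_mem_nhds _ hζ'0)
    (fun i j => badSet (Y i - Y j) ∪ badSet (X i - X j))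
    (fun i j => measure_union_null (badSet_null _) (badSet_null _))
  have hcX : ∀ i < m, ‖c i - X i‖ < ζ' := by
    intro i hi
    have := (hc i hi).1
    rwa [mem_ball, dist_eq_norm] at this
  obtain ⟨H1, he1, hp1, hb1⟩ := push_points m Y c (s + ζ') (by positivity)
    (fun i hi => by
      have h1 := hcX i hi
      have h2 := hYX i hi
      have h3 := norm_add_le (c i - X i) (X i - Y i)
      rw [sub_add_sub_cancel] at h3
      linarith)
    (fun i hi j hj t _ => by
      have h1 : c i - c j ∉ badSet (Y i - Y j) := fun h => (hc i hi).2 j hj (Or.inl h)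
      have h2 := not_bad _ _ (hYd i hi j hj) h1 t
      convert h2 using 2
      module)
  obtain ⟨H2, he2, hp2, hb2⟩ := push_points m c X ζ' hζ'0.le
    (fun i hi => by
      rw [norm_sub_rev]; exact (hcX i hi).le)
    (fun i hi j hj t _ => by
      have h1 : c i - c j ∉ badSet (X i - X j) := fun h => (hc i hi).2 j hj (Or.inr h)
      have h2 := not_bad _ _ (hXd i hi j hj) h1 (1 - t)
      convert h2 using 2
      module)
  refine closed_loop_mem F (H1.trans H2) δ (s + 2 * ζ') (by rw [hζ']; linarith) hF ?_ hst ?_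
    (fun i => if i < m then x' i else x' 0 + w) m hm w hw ?_ ?_
  · intro z u hu
    simp only [Homeomorph.trans_apply]
    rw [he1 z u hu, he2 _ u hu]
  · intro z
    simp only [Homeomorph.trans_apply]
    have h1 := hb1 z
    have h2 := hb2 (H1 z)
    have h3 := norm_add_le (H2 (H1 z) - H1 z) (H1 z - z)
    rw [sub_add_sub_cancel] at h3
    linarith
  · intro i hi
    simp only [Homeomorph.trans_apply, if_pos hi]
    have := hp1 i hi
    simp only [hY] at this
    rw [this, hp2 i hi]
  · simp [hm]

lemma rotSet_nonempty (F : R2 ≃ₜ R2) (hF : Equivar F) : (rotSet F).Nonempty := by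
  obtain ⟨M, hM0, hM⟩ := disp_bdd F F.continuous hF
  have hb : ∀ n : ℕ, ((n : ℝ))⁻¹ • ((⇑F)^[n] 0 - 0) ∈ closedBall (0 : R2) M := by
    intro n
    rw [mem_closedBall_zero_iff, norm_smul, norm_inv, Real.norm_natCast]
    have h1 := iter_bdd F M hM n 0
    rcases Nat.eq_zero_or_pos n with rfl | hn
    · simpa using hM0
    · have : (0 : ℝ) < n := by exact_mod_cast hn
      rw [inv_mul_le_iff₀ this]; exact h1
  obtain ⟨v, _, φ, hφ, hv⟩ := (isCompact_closedBall (0 : R2) M).tendsto_subseq hb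
  exact ⟨v, fun _ => 0, φ, hφ.tendsto_atTop, hv⟩

lemma exists_coloring (η : ℝ) (hη : 0 < η) : ∃ (t : Finset R2) (col : R2 → R2), (∀ z, col z ∈ t) ∧
    ∀ z z', col z = col z' → ∃ w ∈ intLattice, ‖z' - z - w‖ < η := by
  obtain ⟨t, _, htf, htc⟩ := (isCompact_closedBall (0 : R2) 1).finite_cover_balls (half_pos hη)
  have : ∀ z : R2, ∃ c ∈ t, ∃ w ∈ intLattice, ‖z - w - c‖ < η / 2 := by
    intro z
    obtain ⟨w, hw, hz⟩ := exists_lattice_near z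
    have h1 : z - w ∈ closedBall (0 : R2) 1 := by rwa [mem_closedBall_zero_iff]
    obtain ⟨c, hc, hcz⟩ := mem_iUnion₂.1 (htc h1)
    rw [mem_ball, dist_eq_norm] at hcz
    exact ⟨c, hc, w, hw, hcz⟩
  choose col hcol W hW hn using this
  refine ⟨htf.toFinset, col, fun z => htf.mem_toFinset.2 (hcol z), fun z z' h => ?_⟩
  refine ⟨W z' - W z, intLattice.sub_mem (hW z') (hW z), ?_⟩
  have h1 := hn z
  have h2 := hn z'
  rw [← h] at h2
  have h3 := norm_sub_le (z' - W z' - col z) (z - W z - col z)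
  have h4 : z' - z - (W z' - W z) = (z' - W z' - col z) - (z - W z - col z) := by abel
  rw [h4]; linarith

lemma decomp (F : R2 ≃ₜ R2) (δ : ℝ) (hδ : 0 < δ) (hF : Equivar F)
    (hst : UpperStable Homeo0 F δ) : ∃ C > 0, ∀ x : ℕ → R2, IsPseudoOrbit F (δ / 2) x →
    ∀ n : ℕ, ∃ p ∈ (n : ℝ) • rotSet F, ‖x n - x 0 - p‖ ≤ C := by
  obtain ⟨M, hM0, hM⟩ := disp_bdd F F.continuous hF
  obtain ⟨v0, hv0⟩ := rotSet_nonempty F hF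
  have hconv := rotSet_convex F hF
  obtain ⟨t, col, hcol, hsame⟩ := exists_coloring (δ / 4) (by positivity)
  set K : ℝ := M + δ / 2 + ‖v0‖ + δ / 4 with hK
  have hK0 : 0 < K := by positivity
  refine ⟨K * t.card + 1, by positivity, fun x hx => ?_⟩
  have hx' : ∀ i, ‖F (x i) - x (i + 1)‖ < δ / 2 := fun i => by
    have := hx i; rwa [dist_eq_norm] at this
  have key : ∀ N : ℕ, ∀ S : Finset R2, S.card ≤ N → ∀ d i : ℕ,
      (∀ k, i ≤ k → k ≤ i + d → col (x k) ∈ S) →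
      ∃ p ∈ (d : ℝ) • rotSet F, ‖x (i + d) - x i - p‖ ≤ K * N := by
    intro N
    induction N with
    | zero =>
      intro S hS d i h
      have := h i le_rfl (by omega)
      rw [Finset.card_eq_zero.1 (Nat.le_zero.1 hS)] at this
      simp at this
    | succ N ih =>
      intro S hS d i h
      classical
      set P : ℕ → Prop := fun a => col (x (i + a)) = col (x i) with hP
      set a := Nat.findGreatest P d with ha
      have had : a ≤ d := Nat.findGreatest_le d
      have hPa : P a := Nat.findGreatest_spec (P := P) (Nat.zero_le d) rfl
      have hPk : ∀ k, a < k → k ≤ d → ¬ P k := fun k h1 h2 => Nat.findGreatest_is_greatest h1 h2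
      obtain ⟨p1, hp1, hn1⟩ : ∃ p ∈ (a : ℝ) • rotSet F, ‖x (i + a) - x i - p‖ ≤ δ / 4 := by
        rcases Nat.eq_zero_or_pos a with h0 | h0
        · rw [h0]
          refine ⟨((0 : ℕ) : ℝ) • v0, smul_mem_smul_set hv0, ?_⟩
          simp; positivity
        · obtain ⟨w, hw, hnw⟩ := hsame (x i) (x (i + a)) hPa.symm
          have hl := loop_mem F δ (δ / 2 + δ / 4) (by linarith) hF hst
            (fun k => if k < a then x (i + k) else x i + w) a h0 w hw ?_ ?_
          · refine ⟨w, ?_, hnw.le⟩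
            have hne : (a : ℝ) ≠ 0 := by positivity
            have := smul_mem_smul_set (a := (a : ℝ)) hl
            rwa [smul_smul, mul_one_div_cancel hne, one_smul] at this
          · intro k hk
            simp only [if_pos hk]
            have h1 := hx' (i + k)
            by_cases h2 : k + 1 < a
            · rw [if_pos h2, ← add_assoc]; linarith
            · rw [if_neg h2]
              have h3 : i + k + 1 = i + a := by omega
              rw [h3] at h1
              have h4 := norm_add_le (F (x (i + k)) - x (i + a)) (x (i + a) - x i - w)
              have h5 : F (x (i + k)) - (x i + w) =
                (F (x (i + k)) - x (i + a)) + (x (i + a) - x i - w) := by abel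
              rw [h5]; linarith
          · simp [h0]
      rcases Nat.eq_or_lt_of_le had with h0 | h0
      · rw [h0] at hp1 hn1
        refine ⟨p1, hp1, hn1.trans ?_⟩
        have h1 : δ / 4 ≤ K := by rw [hK]; linarith [norm_nonneg v0]
        have h2 : 0 ≤ K * N := by positivity
        push_cast; linarith
      · obtain ⟨e, he⟩ := Nat.exists_eq_add_of_lt h0
        obtain ⟨p2, hp2, hn2⟩ := ih (S.erase (col (x i)))
          (by
            rw [Finset.card_erase_of_mem (h i le_rfl (by omega))]; omega) e (i + a + 1)
          (fun k h1 h2 => by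
            refine Finset.mem_erase.2 ⟨?_, h k (by omega) (by omega)⟩
            have := hPk (k - i) (by omega) (by omega)
            simp only [hP] at this
            rwa [Nat.add_sub_cancel' (by omega)] at this)
        refine ⟨p1 + ((1 : ℝ) • v0 + p2), ?_, ?_⟩
        · have : (d : ℝ) = a + (1 + e) := by rw [he]; push_cast; ring
          rw [this, hconv.add_smul (by positivity) (by positivity),
            hconv.add_smul (by positivity) (by positivity)]
          exact add_mem_add hp1 (add_mem_add (smul_mem_smul_set hv0) hp2)
        · have e1 : i + d = i + a + 1 + e := by omega
          rw [e1]
          have h1 : x (i + a + 1 + e) - x i - (p1 + ((1 : ℝ) • v0 + p2)) =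
            (x (i + a) - x i - p1) + ((F (x (i + a)) - x (i + a)) - (F (x (i + a)) - x (i + a + 1))
              - v0) + (x (i + a + 1 + e) - x (i + a + 1) - p2) := by
            rw [one_smul]; abel
          rw [h1]
          have h2 := norm_add₃_le (a := x (i + a) - x i - p1)
            (b := (F (x (i + a)) - x (i + a)) - (F (x (i + a)) - x (i + a + 1)) - v0)
            (c := x (i + a + 1 + e) - x (i + a + 1) - p2)
          have h3 := norm_sub_le ((F (x (i + a)) - x (i + a)) - (F (x (i + a)) - x (i + a + 1))) v0
          have h4 := norm_sub_le (F (x (i + a)) - x (i + a)) (F (x (i + a)) - x (i + a + 1))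
          have h5 := hM (x (i + a))
          have h6 := hx' (i + a)
          push_cast
          rw [mul_add, mul_one]
          nth_rewrite 2 [hK]
          linarith
  intro n
  obtain ⟨p, hp, hn⟩ := key t.card t le_rfl n 0 (fun k _ _ => hcol _)
  rw [zero_add] at hn
  exact ⟨p, hp, by linarith⟩

lemma lift_diff (f : T2 ≃ₜ T2) (F F₀ : R2 ≃ₜ R2) (h : IsLift f F) (h₀ : IsLift f F₀) :
    ∃ k ∈ intLattice, ∀ z, F z = F₀ z + k := by
  have h1 : ∀ z, F z - F₀ z ∈ intLattice := by
    intro z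
    have : pr (F₀ z) = pr (F z) := by rw [h.proj, h₀.proj]
    have := QuotientAddGroup.eq.1 this
    rwa [neg_add_eq_sub] at this
  have h2 : ∀ z i, (F z - F₀ z) i = (F 0 - F₀ 0) i := by
    intro z i
    have hN : ∀ z, ∃ n : ℤ, (F z - F₀ z) i = n := fun z => h1 z i
    choose N hN using hN
    have hc : Continuous N := by
      rw [Int.isClosedEmbedding_coe_real.isEmbedding.continuous_iff]
      have : ((↑) : ℤ → ℝ) ∘ N = fun z => (F z - F₀ z) i := by
        funext z; exact (hN z).symm
      rw [this]
      have := F.continuous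
      have := F₀.continuous
      fun_prop
    rw [hN, hN, PreconnectedSpace.constant inferInstance hc]
  refine ⟨F 0 - F₀ 0, h1 0, fun z => ?_⟩
  have : F z - F₀ z = F 0 - F₀ 0 := by
    ext i; exact h2 z i
  rw [← this]; abel

lemma rot_shift (F F₀ : R2 ≃ₜ R2) (h₀ : Equivar F₀) (k : R2) (hk : k ∈ intLattice)
    (h : ∀ z, F z = F₀ z + k) (v : R2) (hv : v ∈ rotSet F₀) : v + k ∈ rotSet F := by
  have hit : ∀ (n : ℕ) z, (⇑F)^[n] z = (⇑F₀)^[n] z + (n : ℝ) • k ∧ (n : ℝ) • k ∈ intLattice := by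
    intro n z
    induction n with
    | zero => simp
    | succ n ih =>
      have e : ((n + 1 : ℕ) : ℝ) • k = (n : ℝ) • k + k := by push_cast; module
      refine ⟨?_, by rw [e]; exact intLattice.add_mem ih.2 hk⟩
      rw [Function.iterate_succ_apply', Function.iterate_succ_apply', ih.1, h, h₀ _ _ ih.2, e]
      abel
  obtain ⟨z, n, hn, hv⟩ := hv
  refine ⟨z, n, hn, ?_⟩
  refine (hv.add_const k).congr' ?_
  filter_upwards [hn.eventually_gt_atTop 0] with j hj
  rw [(hit (n j) (z j)).1, add_sub_right_comm, smul_add, smul_smul,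
    inv_mul_cancel₀ (by positivity), one_smul]

/-- If `f ∈ Homeo₀(T²)` has a `δ`-upper-stable rotation set for some
`δ > 0`, then there is a constant `C > 0` such that for every lift `F` of `f` and
every `(δ/2)`-pseudo-orbit `(x̃_i)` of `F`, one has `d(x̃_n − x̃_0, n·ρ(F)) ≤ C` for
all `n ∈ ℕ`. -/
theorem bounded_deviations_of_upper_stable (f : T2 ≃ₜ T2) (hf : f ∈ Homeo0)
    (δ : ℝ) (hδ : 0 < δ)
    (hstab : ∃ F₀ : R2 ≃ₜ R2, IsLift f F₀ ∧ UpperStable Homeo0 F₀ δ) :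
    ∃ C > 0, ∀ F : R2 ≃ₜ R2, IsLift f F → ∀ x : ℕ → R2,
      IsPseudoOrbit (⇑F) (δ / 2) x →
      ∀ n : ℕ, Metric.infDist (x n - x 0) ((n : ℝ) • rotSet F) ≤ C := by
  obtain ⟨F₀, hF₀, hst⟩ := hstab
  obtain ⟨C, hC, hdec⟩ := decomp F₀ δ hδ hF₀.equivariant hst
  refine ⟨C, hC, fun F hF x hx n => ?_⟩
  obtain ⟨k, hk, hFk⟩ := lift_diff f F F₀ hF hF₀
  have hkn : ∀ n : ℕ, (n : ℝ) • k ∈ intLattice := by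
    intro n
    rw [Nat.cast_smul_eq_nsmul]; exact intLattice.nsmul_mem hk n
  obtain ⟨p, hp, hn⟩ := hdec (fun i => x i - (i : ℝ) • k) (by
    intro i
    have h1 := hx i
    have h2 : F₀ (x i - (i : ℝ) • k) = F₀ (x i) - (i : ℝ) • k := by
      rw [sub_eq_add_neg, hF₀.equivariant _ _ (intLattice.neg_mem (hkn i)), ← sub_eq_add_neg]
    rw [dist_eq_norm, hFk] at h1
    rw [dist_eq_norm, h2]
    convert h1 using 2
    push_cast
    module) n
  obtain ⟨v, hv, rfl⟩ := hp
  have hv' : (n : ℝ) • (v + k) ∈ (n : ℝ) • rotSet F :=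
    smul_mem_smul_set (rot_shift F F₀ hF₀.equivariant k hk hFk v hv)
  refine (infDist_le_dist_of_mem hv').trans ?_
  rw [dist_eq_norm]
  refine le_trans (le_of_eq ?_) hn
  congr 1
  push_cast
  module
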